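/- Suppose k, f, s satisfy (i) k' = k^2 − k·f, (ii) s' = 2·k·s, (iii) f' = f^2 − k·f + 4·s^2 and (iv) k·f = s^2 − c at every point of I, that k(t) ≠ 0 for every t ∈ I, and that the reduced bitension equation 3·s^2 − k^2 − 3·c = 0 holds at every point of I. Then a contradiction follows; i.e., no such configuration exists. (This is the analytic core of the Wang–Ou theorem that every biharmonic Riemannian submersion from a 3-dimensional space form M^3(c) onto a surface is harmonic.) -/

import Mathlib

/-- Analytic core of the Wang–Ou theorem that biharmonic Riemannian submersions
from 3-dimensional space forms onto surfaces are harmonic: along an integral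
curve of `e₁`, the structure equations of the integrability data `k = k₁`,
`f = f₂`, `s = σ` together with `k ≠ 0` and the reduced bitension equation
`3·s² − k² − 3·c = 0` lead to a contradiction. -/
theorem biharmonic_submersion_core_contradiction
    (a b : ℝ) (hab : a < b) (I : Set ℝ) (hI : I = Set.Ioo a b)
    (k f s : ℝ → ℝ) (hk : ContDiff ℝ (⊤ : ℕ∞) k) (hf : ContDiff ℝ (⊤ : ℕ∞) f)
    (hs : ContDiff ℝ (⊤ : ℕ∞) s) (c : ℝ)
    (h1 : ∀ t ∈ I, deriv k t = k t ^ 2 - k t * f t)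
    (h2 : ∀ t ∈ I, deriv s t = 2 * k t * s t)
    (h3 : ∀ t ∈ I, deriv f t = f t ^ 2 - k t * f t + 4 * s t ^ 2)
    (h4 : ∀ t ∈ I, k t * f t = s t ^ 2 - c)
    (hk0 : ∀ t ∈ I, k t ≠ 0)
    (hbi : ∀ t ∈ I, 3 * s t ^ 2 - k t ^ 2 - 3 * c = 0) :
    False := by
  subst hI
  have quadratic_relation : ∀ p q r : ℝ, (∀ t ∈ Set.Ioo a b, p * s t ^ 2 - q * k t ^ 2 - r = 0) →
      ∀ t ∈ Set.Ioo a b,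
        p * (2 * s t * (2 * k t * s t)) - q * (2 * k t * (k t ^ 2 - k t * f t)) = 0 := by
    intro p q r h t ht
    have hs' : HasDerivAt s (2 * k t * s t) t :=
      h2 t ht ▸ (hs.differentiable (by simp) t).hasDerivAt
    have hk' : HasDerivAt k (k t ^ 2 - k t * f t) t :=
      h1 t ht ▸ (hk.differentiable (by simp) t).hasDerivAt
    have hd := (((hs'.pow 2).const_mul p).sub ((hk'.pow 2).const_mul q)).sub_const r
    have hzero : (fun x => p * s x ^ 2 - q * k x ^ 2 - r) =ᶠ[nhds t] fun _ => 0 :=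
      Filter.eventuallyEq_of_mem (isOpen_Ioo.mem_nhds ht) h
    have := hd.unique ((hasDerivAt_const t (0 : ℝ)).congr_of_eventuallyEq hzero)
    norm_num at this
    linarith
  have hsq : ∀ t ∈ Set.Ioo a b, 9 * s t ^ 2 - 1 * k t ^ 2 - 0 = 0 := by
    intro t ht
    have h := quadratic_relation 3 1 (3 * c) (fun x hx => by linarith [hbi x hx]) t ht
    apply mul_left_cancel₀ (hk0 t ht)
    linear_combination (3 / 4) * h - (3 / 2) * k t * h4 t ht - (1 / 2) * k t * hbi t ht
  obtain ⟨t, ht⟩ := Set.nonempty_Ioo.mpr hab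
  have h := quadratic_relation 9 1 0 hsq t ht
  apply pow_ne_zero 3 (hk0 t ht)
  linear_combination (3 / 8) * h - (3 / 4) * k t * h4 t ht - (1 / 4) * k t * hbi t ht -
    (3 / 2) * k t * hsq t ht
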